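/- arXiv:2510.00226 — 6 statements merged into one kernel-verified Lean document; each statement's English description precedes it below -/
import Mathlib

section
/- For all integers m ≥ 0 and n ≥ 1, the number of (m,n)-words equals ∑_{k=1}^{n} C(m+k, k) · C(n-1, k-1), where C denotes the binomial coefficient. -/
/-- An `(m,n)`-word: a word `w₁…wₙ` of length `n` over the alphabet `{0,1,…,m+1}`
such that (MN1) `w₁ ≠ m+1`, and (MN2) for `1 ≤ s ≤ m`, `wᵢ = s` implies `wⱼ ≥ s`
for all `j < i`. -/
def IsMNWord (m n : ℕ) (w : List ℕ) : Prop :=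
  w.length = n ∧
  (∀ x ∈ w, x ≤ m + 1) ∧
  (∀ h0 : 0 < w.length, w[0] ≠ m + 1) ∧
  (∀ (i j : ℕ) (hi : i < w.length) (hj : j < w.length),
    j < i → 1 ≤ w[i] → w[i] ≤ m → w[i] ≤ w[j])

/-- The words `s :: t` with `s ≤ c` and `t ∈ A s`. -/
def prependUpTo (A : ℕ → Finset (List ℕ)) (c : ℕ) : Finset (List ℕ) :=
  (Finset.range (c + 1)).biUnion fun s => (A s).image (List.cons s)

lemma mem_prependUpTo {A : ℕ → Finset (List ℕ)} {c x : ℕ} {t : List ℕ} :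
    x :: t ∈ prependUpTo A c ↔ x ≤ c ∧ t ∈ A x := by
  simp [prependUpTo]

lemma nil_notMem_prependUpTo (A : ℕ → Finset (List ℕ)) (c : ℕ) : [] ∉ prependUpTo A c := by
  simp [prependUpTo]

lemma card_prependUpTo (A : ℕ → Finset (List ℕ)) (c : ℕ) :
    (prependUpTo A c).card = ∑ s ∈ Finset.range (c + 1), (A s).card := by
  rw [prependUpTo, Finset.card_biUnion]
  · exact Finset.sum_congr rfl fun s _ => Finset.card_image_of_injective _ List.cons_injective
  · intro s _ s' _ h
    rw [Function.onFun, Finset.disjoint_left]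
    simp only [Finset.mem_image]
    grind

/-- The words of length `n` that can follow, in an `(m, _)`-word, a nonempty prefix with least
letter `c ≤ m`. -/
def continuations (m : ℕ) : ℕ → ℕ → Finset (List ℕ)
  | 0, _ => {[]}
  | n + 1, c => (continuations m n c).image (List.cons (m + 1)) ∪
      prependUpTo (continuations m n) c

lemma mem_continuations {m n c : ℕ} (hc : c ≤ m) {t : List ℕ} :
    t ∈ continuations m n c ↔ t.length = n ∧ (∀ y ∈ t, y ≤ m + 1) ∧
      (∀ y ∈ t, 1 ≤ y → y ≤ m → y ≤ c) ∧
      t.Pairwise fun a b => 1 ≤ b → b ≤ m → b ≤ a := by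
  induction n generalizing c t with
  | zero => cases t <;> simp [continuations]
  | succ n ih =>
    cases t with
    | nil => simp [continuations, nil_notMem_prependUpTo]
    | cons x t =>
      have key : x :: t ∈ continuations m (n + 1) c ↔
          (x = m + 1 ∧ t ∈ continuations m n c) ∨ (x ≤ c ∧ t ∈ continuations m n x) := by
        simp only [continuations, Finset.mem_union, mem_prependUpTo, Finset.mem_image]
        grind
      rw [key, ih hc, List.pairwise_cons]
      by_cases hx : x ≤ c
      · rw [ih (hx.trans hc)]
        simp only [List.length_cons, List.mem_cons]
        grind
      · simp only [List.length_cons, List.mem_cons]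
        grind

lemma isMNWord_iff_mem {m n : ℕ} {w : List ℕ} :
    IsMNWord m (n + 1) w ↔ w ∈ prependUpTo (continuations m n) m := by
  cases w with
  | nil => simp [IsMNWord, nil_notMem_prependUpTo]
  | cons x t =>
    have hpair : (∀ (i j : ℕ) (hi : i < (x :: t).length) (hj : j < (x :: t).length),
        j < i → 1 ≤ (x :: t)[i] → (x :: t)[i] ≤ m → (x :: t)[i] ≤ (x :: t)[j]) ↔
        (x :: t).Pairwise fun a b => 1 ≤ b → b ≤ m → b ≤ a := by
      rw [List.pairwise_iff_getElem]
      exact ⟨fun h i j hi hj => h j i hj hi, fun h i j hi hj => h j i hj hi⟩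
    rw [IsMNWord, hpair, mem_prependUpTo, List.pairwise_cons]
    by_cases hx : x ≤ m
    · rw [mem_continuations hx]
      simp only [List.length_cons, List.mem_cons, List.getElem_cons_zero]
      grind
    · refine iff_of_false (fun ⟨_, hle, hne, _⟩ => ?_) fun h => hx h.1
      have hxle := hle x List.mem_cons_self
      have hxne : x ≠ m + 1 := hne (Nat.succ_pos _)
      omega

lemma sum_range_choose_mul_add_choose (n c : ℕ) :
    ∑ s ∈ Finset.range (c + 1), ∑ j ∈ Finset.range (n + 1), n.choose j * (s + j).choose j =
      ∑ j ∈ Finset.range (n + 1), n.choose j * (c + (j + 1)).choose (j + 1) := by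
  rw [Finset.sum_comm]
  refine Finset.sum_congr rfl fun j _ => ?_
  rw [← Finset.mul_sum, Nat.sum_range_add_choose, add_assoc]

lemma card_continuations {m n c : ℕ} (hc : c ≤ m) :
    (continuations m n c).card =
      ∑ j ∈ Finset.range (n + 1), n.choose j * (c + j).choose j := by
  induction n generalizing c with
  | zero => simp [continuations]
  | succ n ih =>
    rw [continuations, Finset.card_union_of_disjoint, card_prependUpTo,
      Finset.card_image_of_injective _ List.cons_injective, ih hc,
      Finset.sum_congr rfl fun s hs => ih (by grind : s ≤ m), sum_range_choose_mul_add_choose,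
      Finset.sum_range_succ' _ (n + 1)]
    · simp only [Nat.choose_succ_succ n, add_mul, Finset.sum_add_distrib]
      rw [Finset.sum_range_succ' _ n, Finset.sum_range_succ (fun j => n.choose (j + 1) * _) n]
      simp
      ring
    · rw [Finset.disjoint_left]
      rintro _ h h'
      obtain ⟨t, _, rfl⟩ := Finset.mem_image.mp h
      have := (mem_prependUpTo.mp h').1
      omega

/-- The number of `(m,n)`-words is `∑_{k=1}^{n} C(m+k,k)·C(n-1,k-1)`. -/
theorem mn_words_cardinality (m n : ℕ) (hn : 1 ≤ n) :
    Nat.card {w : List ℕ // IsMNWord m n w} =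
      ∑ k ∈ Finset.Icc 1 n, (m + k).choose k * (n - 1).choose (k - 1) := by
  obtain ⟨n, rfl⟩ := Nat.exists_eq_add_of_le' hn
  rw [Nat.subtype_card (prependUpTo (continuations m n) m) fun _ => isMNWord_iff_mem.symm,
    card_prependUpTo, Finset.sum_congr rfl fun s hs => card_continuations (by grind : s ≤ m),
    sum_range_choose_mul_add_choose, ← Finset.Ico_add_one_right_eq_Icc,
    Finset.sum_Ico_eq_sum_range]
  refine Finset.sum_congr (by simp) fun j _ => ?_
  simp [add_comm 1 j, mul_comm]
end

section
/- For all integers m ≥ 0 and n ≥ 1, the number of two-toned tilings of length m+n equals ∑_{k=1}^{n} C(m+k, k) · C(n-1, k-1), where C denotes the binomial coefficient. -/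
/-- A two-toned tiling of length `m+n`: a list of tiles (a tile is either a red
square, modeled by `none`, or a blue strip of positive length `b`, modeled by
`some b`) containing exactly `m` red squares and whose blue lengths sum to `n`. -/
def IsTwoTonedTiling (m n : ℕ) (T : List (Option ℕ+)) : Prop :=
  T.countP (fun t => t.isNone) = m ∧
  ((T.filterMap id).map (fun b : ℕ+ => (b : ℕ))).sum = n

/-- The number of lists of `k` positive integers with sum `n`. -/
def numCompositions : ℕ → ℕ → ℕ
  | 0, n => if n = 0 then 1 else 0
  | k + 1, n => ∑ j ∈ Finset.range n, numCompositions k j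

theorem numCompositions_succ_succ (k n : ℕ) : numCompositions (k + 1) (n + 1) = n.choose k := by
  induction k generalizing n with
  | zero => simp [numCompositions]
  | succ k ih =>
    rw [numCompositions, Finset.sum_range_succ', show numCompositions (k + 1) 0 = 0 by
      simp [numCompositions], add_zero]
    simp only [ih]
    induction n with
    | zero => simp
    | succ n ihn => rw [Finset.sum_range_succ, ihn, Nat.choose_succ_succ', add_comm]

/-- Prepend a red square. -/
def consRed : List (Option ℕ+) ↪ List (Option ℕ+) := ⟨List.cons none, List.cons_injective⟩

/-- Prepend a blue strip. -/
def consBlue (b : ℕ+) : List (Option ℕ+) ↪ List (Option ℕ+) :=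
  ⟨List.cons (some b), List.cons_injective⟩

/-- The tilings with `m` red squares and `k` blue strips of total length `n`, constructed by
choosing the first tile. -/
def tilings : ℕ → ℕ → ℕ → Finset (List (Option ℕ+))
  | 0, 0, n => if n = 0 then {[]} else ∅
  | m + 1, 0, n => (tilings m 0 n).map consRed
  | 0, k + 1, n => (Finset.range n).biUnion fun j =>
      (tilings 0 k j).map (consBlue (n - j - 1).succPNat)
  | m + 1, k + 1, n => (tilings m (k + 1) n).map consRed ∪ (Finset.range n).biUnion fun j =>
      (tilings (m + 1) k j).map (consBlue (n - j - 1).succPNat)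

theorem exists_succPNat_sub_iff (b : ℕ+) (n s : ℕ) :
    (s < n ∧ (n - s - 1).succPNat = b) ↔ (b : ℕ) + s = n := by
  have hb := b.pos
  rw [← PNat.coe_inj, Nat.succPNat_coe]
  omega

theorem mem_tilings (T : List (Option ℕ+)) (m k n : ℕ) :
    T ∈ tilings m k n ↔ T.countP (fun t => t.isNone) = m ∧ (T.filterMap id).length = k ∧
      ((T.filterMap id).map (fun b : ℕ+ => (b : ℕ))).sum = n := by
  induction T generalizing m k n with
  | nil =>
    rcases m with _ | m <;> rcases k with _ | k <;>
      simp [tilings, consRed, consBlue]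
    split_ifs <;> simp_all [eq_comm]
  | cons t T ih =>
    rcases t with _ | b
    · rcases m with _ | m <;> rcases k with _ | k <;>
        simp [tilings, consRed, consBlue, ih]
      split_ifs <;> simp
    · have key := exists_succPNat_sub_iff b n ((T.filterMap id).map (fun b : ℕ+ => (b : ℕ))).sum
      rcases m with _ | m <;> rcases k with _ | k <;>
        simp [tilings, consRed, consBlue, ih]
      · split_ifs <;> simp
      all_goals grind

theorem card_biUnion_consBlue (n : ℕ) (f : ℕ → Finset (List (Option ℕ+))) :
    ((Finset.range n).biUnion fun j => (f j).map (consBlue (n - j - 1).succPNat)).card =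
      ∑ j ∈ Finset.range n, (f j).card := by
  rw [Finset.card_biUnion]
  · simp
  · intro i hi j hj hij
    rw [Finset.mem_coe, Finset.mem_range] at hi hj
    rw [Function.onFun, Finset.disjoint_left]
    simp only [Finset.mem_map, consBlue, Function.Embedding.coeFn_mk]
    rintro _ ⟨a, -, rfl⟩ ⟨c, -, h⟩
    simp only [List.cons.injEq, Option.some.injEq, Nat.succPNat_inj] at h
    omega

theorem card_tilings (m k n : ℕ) :
    (tilings m k n).card = (m + k).choose k * numCompositions k n := by
  induction m, k, n using tilings.induct with
  | case1 => simp [tilings, numCompositions]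
  | case2 n hn => simp [tilings, numCompositions, hn]
  | case3 m n ih => simpa [tilings] using ih
  | case4 k n ih =>
    rw [tilings, card_biUnion_consBlue]
    simp [ih, numCompositions]
  | case5 m k n ih₁ ih₂ =>
    rw [tilings, Finset.card_union_of_disjoint, card_biUnion_consBlue, Finset.card_map, ih₁]
    · simp only [ih₂, ← Finset.mul_sum]
      rw [← numCompositions, ← add_mul, show m + 1 + (k + 1) = (m + 1 + k) + 1 by ring,
        Nat.choose_succ_succ', show m + (k + 1) = m + 1 + k by ring, add_comm (Nat.choose _ k)]
    · rw [Finset.disjoint_left]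
      simp only [Finset.mem_map, Finset.mem_biUnion, consRed, consBlue,
        Function.Embedding.coeFn_mk]
      rintro _ ⟨a, -, rfl⟩ ⟨j, -, c, -, h⟩
      simp at h

theorem length_le_sum_map_coe (l : List ℕ+) : l.length ≤ (l.map (fun b : ℕ+ => (b : ℕ))).sum := by
  induction l with
  | nil => simp
  | cons b l ih =>
    have := b.pos
    simp only [List.length_cons, List.map_cons, List.sum_cons]
    omega

/-- The number of two-toned tilings of length `m+n` is
`∑_{k=1}^{n} C(m+k,k)·C(n-1,k-1)`. -/
theorem two_toned_tilings_cardinality (m n : ℕ) (hn : 1 ≤ n) :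
    Nat.card {T : List (Option ℕ+) // IsTwoTonedTiling m n T} =
      ∑ k ∈ Finset.Icc 1 n, (m + k).choose k * (n - 1).choose (k - 1) := by
  have hmem (T : List (Option ℕ+)) :
      T ∈ (Finset.Icc 1 n).biUnion (fun k => tilings m k n) ↔ IsTwoTonedTiling m n T := by
    simp only [Finset.mem_biUnion, Finset.mem_Icc, mem_tilings, IsTwoTonedTiling]
    constructor
    · rintro ⟨k, -, h₁, -, h₂⟩
      exact ⟨h₁, h₂⟩
    · rintro ⟨h₁, h₂⟩
      refine ⟨_, ⟨?_, h₂ ▸ length_le_sum_map_coe _⟩, h₁, rfl, h₂⟩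
      by_contra! h
      rw [Nat.lt_one_iff, List.length_eq_zero_iff] at h
      simp only [h, List.map_nil, List.sum_nil] at h₂
      omega
  rw [Nat.subtype_card _ hmem, Finset.card_biUnion]
  · refine Finset.sum_congr rfl fun k hk => ?_
    rw [Finset.mem_Icc] at hk
    obtain ⟨k, rfl⟩ := Nat.exists_eq_add_of_le' hk.1
    obtain ⟨n, rfl⟩ := Nat.exists_eq_add_of_le' hn
    rw [card_tilings, numCompositions_succ_succ, Nat.add_sub_cancel, Nat.add_sub_cancel]
  · intro i _ j _ hij
    rw [Function.onFun, Finset.disjoint_left]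
    intro T hi hj
    rw [mem_tilings] at hi hj
    exact hij (hi.2.1.symm.trans hj.2.1)
end

section
/- Let m ≥ 0 and n ≥ 1 be integers. Every (m,n)-word 𝔴 can be written uniquely in the form 𝔴 = w₁a⁽¹⁾w₂a⁽²⁾…w_k a⁽ᵏ⁾, where k ∈ {1,…,n}, each a⁽ⁱ⁾ is a (possibly empty) block consisting only of the letter m+1, the lengths of the blocks a⁽¹⁾,…,a⁽ᵏ⁾ sum to n-k, and w₁w₂…w_k is a topless (m,k)-word. That is, the data (k, the topless word w₁…w_k, and the block lengths ℓ₁,…,ℓ_k) exist and are uniquely determined by 𝔴. -/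
/-- A topless `(m,n)`-word: an `(m,n)`-word not containing the letter `m+1`. -/
def IsToplessMNWord (m n : ℕ) (w : List ℕ) : Prop :=
  IsMNWord m n w ∧ (m + 1) ∉ w

/-- The word `u₁cˡ¹u₂cˡ²…` obtained by inserting after each letter of `u` a block of the letter `c`
whose length is the corresponding entry of `l`. -/
abbrev insertBlocks (c : ℕ) (u l : List ℕ) : List ℕ :=
  (List.zipWith (fun a k => a :: List.replicate k c) u l).flatten

theorem isMNWord_iff_pairwise {m n : ℕ} {w : List ℕ} :
    IsMNWord m n w ↔ w.length = n ∧ (∀ x ∈ w, x ≤ m + 1) ∧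
      (∀ h0 : 0 < w.length, w[0] ≠ m + 1) ∧
      w.Pairwise (fun a b => 1 ≤ b → b ≤ m → b ≤ a) := by
  rw [IsMNWord, List.pairwise_iff_getElem]
  constructor
  · rintro ⟨h1, h2, h3, h4⟩
    exact ⟨h1, h2, h3, fun i j hi hj hij => h4 j i hj hi hij⟩
  · rintro ⟨h1, h2, h3, h4⟩
    exact ⟨h1, h2, h3, fun i j hi hj hji => h4 j i hj hi hji⟩

theorem length_insertBlocks (c : ℕ) {u l : List ℕ} (h : u.length = l.length) :
    (insertBlocks c u l).length = u.length + l.sum := by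
  induction u generalizing l with
  | nil => cases l <;> simp_all [insertBlocks]
  | cons a u ih =>
    cases l with
    | nil => simp at h
    | cons k l =>
      have := ih (l := l) (by simpa using h)
      simp only [insertBlocks, List.zipWith_cons_cons, List.flatten_cons, List.length_append,
        List.length_cons, List.length_replicate, List.sum_cons] at this ⊢
      omega

theorem filter_insertBlocks {c : ℕ} {u l : List ℕ} (h : u.length = l.length) (hc : c ∉ u) :
    (insertBlocks c u l).filter (· ≠ c) = u := by
  induction u generalizing l with
  | nil => simp [insertBlocks]
  | cons a u ih =>
    cases l with
    | nil => simp at h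
    | cons k l =>
      have hu := ih (l := l) (by simpa using h) (fun hm => hc (List.mem_cons_of_mem a hm))
      have ha : a ≠ c := fun e => hc (by simp [e])
      simp only [insertBlocks, List.zipWith_cons_cons, List.flatten_cons, List.filter_append] at hu ⊢
      rw [hu]
      simp [ha]

theorem replicate_append_insertBlocks_inj {c : ℕ} {u l l' : List ℕ} {r r' : ℕ} (hc : c ∉ u)
    (hl : u.length = l.length) (hl' : u.length = l'.length)
    (h : List.replicate r c ++ insertBlocks c u l = List.replicate r' c ++ insertBlocks c u l') :
    r = r' ∧ l = l' := by
  induction u generalizing l l' r r' with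
  | nil =>
    have := congrArg List.length h
    cases l <;> cases l' <;> simp_all [insertBlocks]
  | cons a u ih =>
    obtain _ | ⟨k, l⟩ := l
    · simp at hl
    obtain _ | ⟨k', l'⟩ := l'
    · simp at hl'
    have ha : a ≠ c := fun e => hc (by simp [e])
    induction r generalizing r' with
    | zero =>
      cases r' with
      | zero =>
        have := ih (l := l) (l' := l') (r := k) (r' := k')
          (fun hm => hc (List.mem_cons_of_mem a hm))
          (by simpa using hl) (by simpa using hl') (by simpa [insertBlocks] using h)
        simp [this]
      | succ r' => simp [insertBlocks, List.replicate_succ, ha] at h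
    | succ r ihr =>
      cases r' with
      | zero => simp [insertBlocks, List.replicate_succ, ha.symm] at h
      | succ r' =>
        have := ihr (r' := r') (by simpa [List.replicate_succ] using h)
        simpa using this

theorem exists_eq_replicate_append_insertBlocks (c : ℕ) (w : List ℕ) :
    ∃ (r : ℕ) (l : List ℕ), l.length = (w.filter (· ≠ c)).length ∧
      w = List.replicate r c ++ insertBlocks c (w.filter (· ≠ c)) l := by
  induction w with
  | nil => exact ⟨0, [], by simp [insertBlocks]⟩
  | cons a w ih =>
    obtain ⟨r, l, hl, hw⟩ := ih
    by_cases ha : a = c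
    · have hf : (a :: w).filter (· ≠ c) = w.filter (· ≠ c) := by simp [ha]
      rw [hf]
      refine ⟨r + 1, l, hl, ?_⟩
      rw [List.replicate_succ, List.cons_append, ← hw, ha]
    · have hf : (a :: w).filter (· ≠ c) = a :: w.filter (· ≠ c) := by simp [ha]
      rw [hf]
      refine ⟨0, r :: l, by simp only [List.length_cons, hl], ?_⟩
      simp only [insertBlocks, List.replicate_zero, List.nil_append, List.zipWith_cons_cons,
        List.flatten_cons, List.cons_append] at hw ⊢
      rw [← hw]

theorem exists_eq_insertBlocks {c : ℕ} {w : List ℕ} (h : ∀ h0 : 0 < w.length, w[0] ≠ c) :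
    ∃ l : List ℕ, l.length = (w.filter (· ≠ c)).length ∧
      w = insertBlocks c (w.filter (· ≠ c)) l := by
  obtain ⟨r, l, hl, hw⟩ := exists_eq_replicate_append_insertBlocks c w
  cases r with
  | zero => exact ⟨l, hl, by simpa only [List.replicate_zero, List.nil_append] using hw⟩
  | succ r =>
    rw [List.replicate_succ, List.cons_append] at hw
    generalize List.replicate r c ++ insertBlocks c (w.filter (· ≠ c)) l = t at hw
    subst hw
    exact absurd rfl (h (by simp))

theorem IsMNWord.filter_isToplessMNWord {m n : ℕ} {w : List ℕ} (hw : IsMNWord m n w) :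
    IsToplessMNWord m (w.filter (· ≠ m + 1)).length (w.filter (· ≠ m + 1)) := by
  obtain ⟨-, hle, -, hp⟩ := isMNWord_iff_pairwise.1 hw
  have hnot : m + 1 ∉ w.filter (· ≠ m + 1) := by simp
  refine ⟨isMNWord_iff_pairwise.2 ⟨rfl, fun x hx => hle x (List.mem_of_mem_filter hx),
    fun h0 => ne_of_mem_of_not_mem (List.getElem_mem h0) hnot, hp.filter _⟩, hnot⟩

/-- Every `(m,n)`-word `w` can be written uniquely as
`w = w₁a⁽¹⁾w₂a⁽²⁾…w_k a⁽ᵏ⁾`, where `k ∈ [n]`, each `a⁽ⁱ⁾` is a (possibly empty)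
block of `ℓᵢ` copies of the letter `m+1`, the block lengths sum to `n-k`, and
`w₁w₂…w_k` is a topless `(m,k)`-word.  The unique data is the triple
`(k, (w₁,…,w_k), (ℓ₁,…,ℓ_k))`. -/
theorem mn_word_decomposition (m n : ℕ) (hn : 1 ≤ n) (w : List ℕ)
    (hw : IsMNWord m n w) :
    ∃! p : ℕ × List ℕ × List ℕ,
      p.1 ∈ Finset.Icc 1 n ∧
      p.2.1.length = p.1 ∧
      p.2.2.length = p.1 ∧
      IsToplessMNWord m p.1 p.2.1 ∧
      p.2.2.sum = n - p.1 ∧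
      w = (List.zipWith (fun a ℓ => a :: List.replicate ℓ (m + 1)) p.2.1 p.2.2).flatten := by
  obtain ⟨hlen, -, hhead, -⟩ := id hw
  obtain ⟨l, hl, hwl⟩ := exists_eq_insertBlocks hhead
  have htop := hw.filter_isToplessMNWord
  have hpos : 1 ≤ (w.filter (· ≠ m + 1)).length := by
    have hmem : w[0] ∈ w.filter (· ≠ m + 1) := by
      simpa using hhead (by omega)
    exact List.length_pos_of_mem hmem
  have hle : (w.filter (· ≠ m + 1)).length ≤ n := hlen ▸ List.length_filter_le _ _
  have hsum := length_insertBlocks (m + 1) hl.symm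
  rw [← hwl, hlen] at hsum
  refine ⟨(_, w.filter (· ≠ m + 1), l), ⟨Finset.mem_Icc.2 ⟨hpos, hle⟩, rfl, hl, htop,
    by dsimp only; omega, hwl⟩, ?_⟩
  rintro ⟨k, u, l'⟩ ⟨-, hk, hl', ⟨-, hu⟩, -, hw'⟩
  dsimp only at hk hl' hu hw'
  have hul : u.length = l'.length := hk.trans hl'.symm
  have hfu : w.filter (· ≠ m + 1) = u := by
    rw [hw']
    exact filter_insertBlocks hul hu
  rw [hfu] at hl hwl ⊢
  have hll := (replicate_append_insertBlocks_inj (r := 0) (r' := 0) hu hul hl.symm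
    (by simpa only [List.replicate_zero, List.nil_append] using hw'.symm.trans hwl)).2
  rw [hll, hk]
end

section
/- Let m ≥ 0, n ≥ 1, and let T be a two-toned tiling of length m+n with blue strips B₁, B₂, …, B_k listed in order. Let r₀ be the number of red squares before B₁ and, for 1 ≤ i ≤ k−1, let r_i be the number of red squares between B_i and B_{i+1}. Define w_i = m − ∑_{j=0}^{i-1} r_j for 1 ≤ i ≤ k, and let a⁽ⁱ⁾ be the block consisting of |B_i| − 1 copies of the letter m+1. Then the word 𝔴_T = w₁a⁽¹⁾w₂a⁽²⁾…w_k a⁽ᵏ⁾ is an (m,n)-word; in particular, m ≥ w₁ ≥ w₂ ≥ … ≥ w_k ≥ 0 and the total number of letters of 𝔴_T is ∑_{i=1}^{k} |B_i| = n. -/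
/-- The word `a₀ c…c a₁ c…c …` with `k` blocks, where the letter `aᵢ` is followed by `bᵢ - 1`
copies of the letter `c`. -/
def blockWord (c k : ℕ) (a b : ℕ → ℕ) : List ℕ :=
  ((List.range k).map fun i => a i :: List.replicate (b i - 1) c).flatten

theorem length_blockWord (c k : ℕ) (a b : ℕ → ℕ) (hb : ∀ i, 1 ≤ b i) :
    (blockWord c k a b).length = ((List.range k).map b).sum := by
  have h : ∀ i, b i - 1 + 1 = b i := fun i => Nat.sub_add_cancel (hb i)
  simp [blockWord, List.length_flatten, Function.comp_def, h]

theorem le_of_mem_blockWord {m k : ℕ} {a b : ℕ → ℕ} (ha : ∀ i, a i ≤ m) {x : ℕ}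
    (hx : x ∈ blockWord (m + 1) k a b) : x ≤ m + 1 := by
  simp only [blockWord, List.mem_flatten, List.mem_map] at hx
  obtain ⟨_, ⟨i, -, rfl⟩, hx⟩ := hx
  rcases List.mem_cons.1 hx with rfl | hx
  · exact (ha i).trans m.le_succ
  · exact (List.eq_of_mem_replicate hx).le

theorem getElem_zero_blockWord {c k : ℕ} {a b : ℕ → ℕ} (h : 0 < (blockWord c k a b).length) :
    (blockWord c k a b)[0] = a 0 := by
  cases k with
  | zero => simp [blockWord] at h
  | succ k => simp [blockWord, List.range_succ_eq_map]

theorem pairwise_blockWord (m k : ℕ) {a b : ℕ → ℕ} (hanti : Antitone a) :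
    (blockWord (m + 1) k a b).Pairwise fun x y => y ≤ m → y ≤ x := by
  rw [blockWord, List.pairwise_flatten, List.pairwise_map]
  constructor
  · simp only [List.mem_map]
    rintro _ ⟨i, -, rfl⟩
    rw [List.pairwise_cons]
    refine ⟨fun y hy hym => ?_, List.pairwise_replicate.2 (Or.inr fun _ => le_rfl)⟩
    have := List.eq_of_mem_replicate hy
    omega
  · refine List.pairwise_lt_range.imp fun {i j} hij x hx y hy hym => ?_
    have hy' : y = a j := by
      rcases List.mem_cons.1 hy with h | h
      · exact h
      · have := List.eq_of_mem_replicate h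
        omega
    rcases List.mem_cons.1 hx with rfl | h
    · exact hy' ▸ hanti hij.le
    · rw [List.eq_of_mem_replicate h]
      omega

theorem isMNWord_blockWord (m k : ℕ) {a b : ℕ → ℕ} (ha : ∀ i, a i ≤ m) (hanti : Antitone a)
    (hb : ∀ i, 1 ≤ b i) :
    IsMNWord m ((List.range k).map b).sum (blockWord (m + 1) k a b) := by
  refine ⟨length_blockWord _ _ _ _ hb, fun x => le_of_mem_blockWord ha, fun h => ?_, ?_⟩
  · rw [getElem_zero_blockWord h]
    exact ((ha 0).trans_lt m.lt_succ_self).ne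
  · intro i j hi hj hji _ hm
    exact List.pairwise_iff_getElem.1 (pairwise_blockWord m k hanti) j i hj hi hji hm

/-- Reading off the blue strips of the tiling with blue strips `b i` preceded by `r i` red squares each and
followed by `q` red squares. -/
theorem filterMap_id_tiling (k q : ℕ) (r : ℕ → ℕ) (b : ℕ → ℕ+) :
    ((((List.range k).map fun i => List.replicate (r i) (none : Option ℕ+) ++ [some (b i)]).flatten
      ++ List.replicate q none).filterMap id) = (List.range k).map b := by
  simp only [List.filterMap_append, List.filterMap_flatten, List.map_map]
  rw [List.map_eq_flatMap (f := b)]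
  simp [Function.comp_def, List.filterMap_replicate_of_none, ← List.flatMap_def]

theorem antitone_sub_sum_take (m : ℕ) (rs : List ℕ) :
    Antitone fun i => m - (rs.take (i + 1)).sum := fun _ _ hij =>
  Nat.sub_le_sub_left
    ((List.take_sublist_take_left (Nat.succ_le_succ hij)).sum_le_sum fun _ _ => Nat.zero_le _) m

/-- Let `T` be a two-toned tiling of length `m+n` with blue strips `B₁,…,B_k` in
order, where `r₀` red squares precede `B₁`, `rᵢ` red squares lie between `Bᵢ` and
`Bᵢ₊₁` (for `1 ≤ i ≤ k-1`), and the remaining `m - (r₀+…+r_{k-1})` red squares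
come after `B_k`.  With `wᵢ = m - ∑_{j=0}^{i-1} rⱼ` and `a⁽ⁱ⁾` consisting of
`|Bᵢ| - 1` copies of `m+1`, the word `𝔴_T = w₁a⁽¹⁾w₂a⁽²⁾…w_k a⁽ᵏ⁾` is an
`(m,n)`-word. -/
theorem tiling_to_word (m n k : ℕ) (hn : 1 ≤ n)
    (bs : List ℕ+) (hbs : bs.length = k)
    (rs : List ℕ) (hrs : rs.length = k)
    (T : List (Option ℕ+))
    (hT : T = ((List.range k).map (fun i =>
        List.replicate (rs.getD i 0) (none : Option ℕ+) ++
          [some (bs.getD i 1)])).flatten ++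
      List.replicate (m - rs.sum) (none : Option ℕ+))
    (hTT : IsTwoTonedTiling m n T) :
    IsMNWord m n
      (((List.range k).map (fun i =>
        (m - (rs.take (i + 1)).sum) ::
          List.replicate ((bs.getD i 1 : ℕ) - 1) (m + 1))).flatten) := by
  obtain ⟨-, hsum⟩ := hTT
  rw [hT, filterMap_id_tiling, List.map_map] at hsum
  subst hsum
  exact isMNWord_blockWord m k (fun _ => Nat.sub_le _ _) (antitone_sub_sum_take m rs)
    fun i => (bs.getD i 1).pos
end

section
/- For all integers m ≥ 0 and n ≥ 1, there is a bijection between the set W(m,n) of (m,n)-words and the set T(m,n) of two-toned tilings of length m+n; in particular, these two finite sets have the same cardinality. -/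
/-- The word of a tiling: a blue strip of length `b` contributes the number of red squares to its
right, followed by `b - 1` copies of the letter `M`. -/
def tilingWord (M : ℕ) : List (Option ℕ+) → List ℕ
  | [] => []
  | none :: T => tilingWord M T
  | some b :: T =>
    T.countP (fun t => t.isNone) :: (List.replicate ((b : ℕ) - 1) M ++ tilingWord M T)

theorem length_tilingWord (M : ℕ) (T : List (Option ℕ+)) :
    (tilingWord M T).length = ((T.filterMap id).map (fun b : ℕ+ => (b : ℕ))).sum := by
  induction T with
  | nil => rfl
  | cons t T ih =>
    cases t with
    | none => simpa [tilingWord] using ih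
    | some b =>
      have := b.pos
      simp [tilingWord, ih]
      omega

theorem mem_tilingWord {M x : ℕ} {T : List (Option ℕ+)} (hx : x ∈ tilingWord M T) :
    x ≤ T.countP (fun t => t.isNone) ∨ x = M := by
  induction T with
  | nil => simp [tilingWord] at hx
  | cons t T ih =>
    cases t with
    | none =>
      have := ih hx
      simp
      omega
    | some b =>
      simp [tilingWord] at hx
      simp
      rcases hx with h | h | h
      · omega
      · omega
      · exact ih h

theorem pairwise_tilingWord {M : ℕ} {T : List (Option ℕ+)}
    (hT : T.countP (fun t => t.isNone) < M) :
    (tilingWord M T).Pairwise (fun a b => b ≤ a ∨ b = M) := by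
  induction T with
  | nil => simp [tilingWord]
  | cons t T ih =>
    cases t with
    | none =>
      simp at hT
      exact ih (by omega)
    | some b =>
      simp at hT
      simp only [tilingWord, List.pairwise_cons, List.pairwise_append, List.mem_append,
        List.mem_replicate]
      refine ⟨?_, List.pairwise_replicate.2 (by simp), ih hT, ?_⟩
      · rintro x (h | h)
        · exact Or.inr h.2
        · exact mem_tilingWord h
      · rintro a ⟨-, rfl⟩ x h
        have := mem_tilingWord h
        omega

theorem head_tilingWord_le {M x : ℕ} {T : List (Option ℕ+)} {w : List ℕ}
    (h : tilingWord M T = x :: w) : x ≤ T.countP (fun t => t.isNone) := by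
  induction T with
  | nil => simp [tilingWord] at h
  | cons t T ih =>
    cases t with
    | none =>
      have := ih h
      simp
      omega
    | some b =>
      simp [tilingWord] at h
      simp
      omega

theorem replicate_append_tilingWord_inj {M : ℕ} {T T' : List (Option ℕ+)}
    (hT : T.countP (fun t => t.isNone) < M) (hT' : T'.countP (fun t => t.isNone) < M) {i j : ℕ}
    (h : List.replicate i M ++ tilingWord M T = List.replicate j M ++ tilingWord M T') :
    i = j ∧ tilingWord M T = tilingWord M T' := by
  induction i generalizing j with
  | zero =>
    cases j with
    | zero => simpa using h
    | succ j =>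
      simp [List.replicate_succ] at h
      have := head_tilingWord_le h
      omega
  | succ i ih =>
    cases j with
    | zero =>
      simp [List.replicate_succ] at h
      have := head_tilingWord_le h.symm
      omega
    | succ j =>
      simp [List.replicate_succ] at h
      obtain ⟨hij, hw⟩ := ih h
      exact ⟨congrArg (· + 1) hij, hw⟩

theorem tilingWord_inj {M : ℕ} {T T' : List (Option ℕ+)}
    (hT : T.countP (fun t => t.isNone) < M)
    (hc : T.countP (fun t => t.isNone) = T'.countP (fun t => t.isNone))
    (h : tilingWord M T = tilingWord M T') : T = T' := by
  induction T generalizing T' with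
  | nil =>
    rcases T' with _ | ⟨_ | b, T'⟩
    · rfl
    · simp at hc
    · simp [tilingWord] at h
  | cons t T ih =>
    rcases T' with _ | ⟨t', T'⟩
    · cases t
      · simp at hc
      · simp [tilingWord] at h
    · rcases t with _ | b <;> rcases t' with _ | b'
      · simp at hc hT
        rw [ih (by omega) hc h]
      · simp at hc
        have := head_tilingWord_le (T := T) h
        omega
      · simp at hc
        have := head_tilingWord_le (T := T') h.symm
        omega
      · simp only [tilingWord, List.cons.injEq] at h
        simp at hc hT
        obtain ⟨hb, hw⟩ := replicate_append_tilingWord_inj hT (hc ▸ hT) h.2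
        have hbb : b = b' := PNat.eq (by have := b.pos; have := b'.pos; omega)
        rw [ih hT hc hw, hbb]

theorem tilingWord_replicate_none_append (M c : ℕ) (T : List (Option ℕ+)) :
    tilingWord M (List.replicate c none ++ T) = tilingWord M T := by
  induction c with
  | zero => simp
  | succ c ih => simpa [List.replicate_succ, tilingWord] using ih

theorem exists_eq_replicate_append_tilingWord {M : ℕ} {w : List ℕ}
    (hw : w.Pairwise (fun a b => b ≤ a ∨ b = M)) {c : ℕ} (hc : ∀ x ∈ w, x ≤ c ∨ x = M) :
    ∃ (j : ℕ) (T : List (Option ℕ+)), T.countP (fun t => t.isNone) = c ∧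
      w = List.replicate j M ++ tilingWord M T := by
  induction w generalizing c with
  | nil =>
    refine ⟨0, List.replicate c none, by simp [List.countP_replicate], ?_⟩
    simpa [tilingWord] using (tilingWord_replicate_none_append M c []).symm
  | cons k w ih =>
    rw [List.pairwise_cons] at hw
    rcases eq_or_ne k M with rfl | hk
    · obtain ⟨j, T, hT, rfl⟩ := ih hw.2 fun x hx => hc x (List.mem_cons_of_mem _ hx)
      exact ⟨j + 1, T, hT, by simp [List.replicate_succ]⟩
    · have hkc : k ≤ c := (hc k (by simp)).resolve_right hk
      obtain ⟨j, T, hT, rfl⟩ := ih hw.2 hw.1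
      refine ⟨0, List.replicate (c - k) none ++ some j.succPNat :: T, ?_, ?_⟩
      · simp [List.countP_replicate, hT]
        omega
      · rw [tilingWord_replicate_none_append]
        simp [tilingWord, hT]

theorem isMNWord_iff {m n : ℕ} {w : List ℕ} :
    IsMNWord m n w ↔ w.length = n ∧ (∀ x ∈ w, x ≤ m + 1) ∧
      (∀ h0 : 0 < w.length, w[0] ≠ m + 1) ∧
      w.Pairwise (fun a b => b ≤ a ∨ b = m + 1) := by
  rw [IsMNWord, List.pairwise_iff_getElem]
  refine and_congr_right fun _ => and_congr_right fun hle => and_congr_right fun _ => ?_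
  constructor
  · intro h i j hi hj hij
    have := h j i hj hi hij
    have := hle w[j] (List.getElem_mem hj)
    omega
  · intro h i j hi hj hij _ _
    have := h j i hj hi hij
    omega

theorem isMNWord_tilingWord {m n : ℕ} {T : List (Option ℕ+)} (hT : IsTwoTonedTiling m n T) :
    IsMNWord m n (tilingWord (m + 1) T) := by
  obtain ⟨hm, hn⟩ := hT
  refine isMNWord_iff.2 ⟨(length_tilingWord _ T).trans hn, fun x hx => ?_, fun h0 => ?_,
    pairwise_tilingWord (by omega)⟩
  · have := mem_tilingWord hx
    omega
  · obtain ⟨x, w, h⟩ := List.exists_cons_of_length_pos h0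
    have := head_tilingWord_le h
    simp only [h, List.getElem_cons_zero]
    omega

theorem exists_tilingWord_eq {m n : ℕ} {w : List ℕ} (hw : IsMNWord m n w) :
    ∃ T, IsTwoTonedTiling m n T ∧ tilingWord (m + 1) T = w := by
  obtain ⟨hlen, hle, h0, hpw⟩ := isMNWord_iff.1 hw
  obtain ⟨j, T, hT, rfl⟩ := exists_eq_replicate_append_tilingWord hpw (c := m) fun x hx => by
    have := hle x hx
    omega
  cases j with
  | zero =>
    exact ⟨T, ⟨hT, by rw [← length_tilingWord (m + 1)]; simpa using hlen⟩, by simp⟩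
  | succ j => simp [List.replicate_succ] at h0

/-- There is a bijection between the set of `(m,n)`-words and the set of
two-toned tilings of length `m+n`; in particular the two sets have the same
cardinality. -/
theorem mn_words_equiv_two_toned_tilings (m n : ℕ) (hn : 1 ≤ n) :
    Nonempty ({w : List ℕ // IsMNWord m n w} ≃
        {T : List (Option ℕ+) // IsTwoTonedTiling m n T}) ∧
    Nat.card {w : List ℕ // IsMNWord m n w} =
      Nat.card {T : List (Option ℕ+) // IsTwoTonedTiling m n T} := by
  let f : {T : List (Option ℕ+) // IsTwoTonedTiling m n T} → {w : List ℕ // IsMNWord m n w} :=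
    fun T => ⟨tilingWord (m + 1) T.1, isMNWord_tilingWord T.2⟩
  have hf : Function.Bijective f := by
    constructor
    · rintro ⟨T, hT⟩ ⟨T', hT'⟩ h
      exact Subtype.ext (tilingWord_inj (hT.1.trans_lt m.lt_succ_self) (hT.1.trans hT'.1.symm)
        (congrArg Subtype.val h))
    · rintro ⟨w, hw⟩
      obtain ⟨T, hT, h⟩ := exists_tilingWord_eq hw
      exact ⟨⟨T, hT⟩, Subtype.ext h⟩
  have e := (Equiv.ofBijective f hf).symm
  exact ⟨⟨e⟩, Nat.card_congr e⟩
end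

section
/- For all integers m ≥ 0 and n ≥ 1, the map ξ⁻¹ sending a two-toned tiling T of length m+n to the word 𝔴_T — where, if B₁,…,B_k are the blue strips of T in order, r₀ is the number of red squares before B₁, r_i (1 ≤ i ≤ k−1) is the number of red squares between B_i and B_{i+1}, w_i = m − ∑_{j=0}^{i-1} r_j, and 𝔴_T = w₁a⁽¹⁾w₂a⁽²⁾…w_k a⁽ᵏ⁾ with a⁽ⁱ⁾ consisting of |B_i| − 1 copies of m+1 — is injective on the set of two-toned tilings of length m+n. -/
/-- The word `𝔴_T` associated to a two-toned tiling `T`: scanning the tiles from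
left to right while keeping track of the number `r` of red squares seen so far,
each blue strip of length `b` contributes the letter `m - r` followed by `b - 1`
copies of the letter `m+1` (so that, with `B₁,…,B_k` the blue strips in order and
`rⱼ` the red counts before/between them, `𝔴_T = w₁a⁽¹⁾…w_k a⁽ᵏ⁾` with
`wᵢ = m - ∑_{j=0}^{i-1} rⱼ` and `a⁽ⁱ⁾` consisting of `|Bᵢ| - 1` copies of `m+1`). -/
def tilingToWordAux (m : ℕ) : ℕ → List (Option ℕ+) → List ℕ
  | _, [] => []
  | r, none :: T => tilingToWordAux m (r + 1) T
  | r, some b :: T =>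
      (m - r) :: (List.replicate ((b : ℕ) - 1) (m + 1) ++ tilingToWordAux m r T)

theorem List.replicate_append_inj_of_head_ne {α : Type*} {x : α} {l l' : List α}
    (hl : ∀ y ∈ l.head?, y ≠ x) (hl' : ∀ y ∈ l'.head?, y ≠ x) {a b : ℕ}
    (h : List.replicate a x ++ l = List.replicate b x ++ l') : a = b ∧ l = l' := by
  induction a generalizing b with
  | zero =>
    cases b with
    | zero => simpa using h
    | succ b =>
      have hx : l = x :: (List.replicate b x ++ l') := by simpa [List.replicate_succ] using h
      exact absurd rfl (hl x (by simp [hx]))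
  | succ a ih =>
    cases b with
    | zero =>
      have hx : l' = x :: (List.replicate a x ++ l) := by
        simpa [List.replicate_succ] using h.symm
      exact absurd rfl (hl' x (by simp [hx]))
    | succ b =>
      obtain ⟨hab, hll⟩ := ih (b := b) (by simpa [List.replicate_succ] using h)
      exact ⟨congrArg Nat.succ hab, hll⟩

theorem le_of_mem_head?_tilingToWordAux {m r : ℕ} {T : List (Option ℕ+)} :
    ∀ y ∈ (tilingToWordAux m r T).head?, y ≤ m - r := by
  induction T generalizing r with
  | nil => simp [tilingToWordAux]
  | cons t T ih =>
    cases t with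
    | none =>
      intro y hy
      have := ih (r := r + 1) y (by simpa [tilingToWordAux] using hy)
      omega
    | some b => simp [tilingToWordAux]

theorem tilingToWordAux_none_cons_ne_some_cons {m r : ℕ} (hr : r < m) (b : ℕ+)
    (T T' : List (Option ℕ+)) :
    tilingToWordAux m r (none :: T) ≠ tilingToWordAux m r (some b :: T') := by
  intro h
  have := le_of_mem_head?_tilingToWordAux (m := m) (r := r + 1) (T := T) (m - r) (by
    rw [tilingToWordAux] at h
    simp [h, tilingToWordAux])
  omega

theorem tilingToWordAux_injective {m r : ℕ} {T T' : List (Option ℕ+)}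
    (hT : r + T.countP (fun t => t.isNone) = m) (hT' : r + T'.countP (fun t => t.isNone) = m)
    (h : tilingToWordAux m r T = tilingToWordAux m r T') : T = T' := by
  induction T generalizing r T' with
  | nil =>
    rcases T' with _ | ⟨_ | b, T'⟩
    · rfl
    · simp at hT hT'
      omega
    · simp [tilingToWordAux] at h
  | cons t T ih =>
    rcases t with _ | a <;> rcases T' with _ | ⟨_ | b, T'⟩
    · simp at hT hT'
      omega
    · simp only [List.countP_cons, Option.isNone_none, if_true] at hT hT'
      rw [ih (r := r + 1) (T' := T') (by omega) (by omega) (by simpa [tilingToWordAux] using h)]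
    · simp only [List.countP_cons, Option.isNone_none, if_true] at hT
      exact absurd h (tilingToWordAux_none_cons_ne_some_cons (by omega) b T T')
    · simp [tilingToWordAux] at h
    · simp only [List.countP_cons, Option.isNone_none, if_true] at hT'
      exact absurd h.symm (tilingToWordAux_none_cons_ne_some_cons (by omega) a T' T)
    · have head_ne (S : List (Option ℕ+)) :
          ∀ y ∈ (tilingToWordAux m r S).head?, y ≠ m + 1 := fun y hy => by
        have := le_of_mem_head?_tilingToWordAux y hy
        omega
      rw [tilingToWordAux, tilingToWordAux, List.cons.injEq] at h
      obtain ⟨hab, hw⟩ := List.replicate_append_inj_of_head_ne (head_ne T) (head_ne T') h.2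
      have ha := a.pos
      have hb := b.pos
      have hab' : a = b := PNat.eq (by omega)
      rw [hab', ih (T' := T') (by simpa using hT) (by simpa using hT') hw]

/-- The map `ξ⁻¹` sending a two-toned tiling `T` of length `m+n` to the word
`𝔴_T` is injective on the set of two-toned tilings of length `m+n`. -/
theorem tiling_to_word_injective (m n : ℕ) (hn : 1 ≤ n) :
    Set.InjOn (tilingToWordAux m 0) {T | IsTwoTonedTiling m n T} := by
  intro T hT T' hT' h
  exact tilingToWordAux_injective ((zero_add _).trans hT.1) ((zero_add _).trans hT'.1) h
end
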